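/- arXiv:1404.4715 — 2 statements merged into one kernel-verified Lean document; each statement's English description precedes it below -/
import Mathlib

section
/- Let m ≥ 3 and let η assign to each unordered pair {i,j} of distinct elements of {1,…,m} a value η_{ij} ∈ ℝ∞ (edge weights on the complete graph K_m). Suppose that for every three distinct vertices i, j, k, the minimum of the three values η_{ij}, η_{ik}, η_{jk} is attained at least twice. Then for every cycle in K_m, i.e. every sequence of pairwise distinct vertices v_1,…,v_a with a ≥ 3, the minimum of the a values η_{v_1 v_2}, η_{v_2 v_3}, …, η_{v_{a−1} v_a}, η_{v_a v_1} is attained at least twice: there are two distinct edges of the cycle whose weights both equal this minimum. -/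
open scoped Classical

/-- `ℝ∞ = ℝ ∪ {∞}`. -/
abbrev RInf := WithTop ℝ

/-- The minimum of three values in `ℝ∞` is attained at least twice. -/
def TwiceMin3 (x y z : RInf) : Prop :=
  ∃ p q : Fin 3, p ≠ q ∧
    ![x, y, z] p = min x (min y z) ∧ ![x, y, z] q = min x (min y z)

/-- If the minimum of three values is attained twice, any two of them being larger than `w`
forces the third to be larger than `w`. -/
theorem TwiceMin3.lt_snd {x y z w : RInf} (h : TwiceMin3 x y z) (hx : w < x) (hz : w < z) :
    w < y := by
  obtain ⟨p, q, hpq, hp, hq⟩ := h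
  by_contra! hy
  have hxy : y < x := hy.trans_lt hx
  have hyz : y < z := hy.trans_lt hz
  rw [min_eq_left hyz.le, min_eq_right hxy.le] at hp hq
  fin_cases p <;> fin_cases q <;> simp_all

open Fin.CommRing in
/-- Under the triangle condition, if all edges of a closed injective sequence other than the one
leaving `l` have weight larger than `w`, then so does every chord starting at `l + 1`. -/
theorem lt_chord_of_lt_edges {V : Type*} {η : V → V → RInf}
    (htri : ∀ i j k : V, i ≠ j → i ≠ k → j ≠ k → TwiceMin3 (η i j) (η i k) (η j k))
    {a : ℕ} [NeZero a] (ha : 2 ≤ a) {vtx : Fin a → V} (hinj : Function.Injective vtx)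
    {l : Fin a} {w : RInf} (hw : ∀ t, t ≠ l → w < η (vtx t) (vtx (t + 1)))
    (k : ℕ) (hk : k + 1 < a) :
    w < η (vtx (l + 1)) (vtx (l + 1 + ((k + 1 : ℕ) : Fin a))) := by
  have hne : ∀ n : ℕ, 0 < n → n < a → (n : Fin a) ≠ 0 := fun n h0 hn h =>
    Nat.not_dvd_of_pos_of_lt h0 hn ((Fin.natCast_eq_zero).1 h)
  have hl : ∀ n : ℕ, n + 1 < a → l + 1 + (n : Fin a) ≠ l := fun n hn h =>
    hne (n + 1) n.succ_pos hn (by push_cast; linear_combination h)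
  have hone : (1 : Fin a) ≠ 0 := by simpa using hne 1 one_pos ha
  have hstep : ∀ n : ℕ, n + 1 < a →
      w < η (vtx (l + 1 + (n : Fin a))) (vtx (l + 1 + ((n + 1 : ℕ) : Fin a))) := fun n hn => by
    simpa [add_assoc] using hw _ (hl n hn)
  induction k with
  | zero => simpa using hstep 0 hk
  | succ k ih =>
    refine (htri _ (vtx (l + 1 + ((k + 1 : ℕ) : Fin a))) _ (hinj.ne fun h => ?_)
      (hinj.ne fun h => ?_) (hinj.ne fun h => ?_)).lt_snd (ih (by omega)) (hstep (k + 1) hk)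
    · exact hne (k + 1) (by omega) (by omega) (by linear_combination -h)
    · exact hne (k + 1 + 1) (by omega) (by omega) (by linear_combination -h)
    · exact hone (by push_cast at h; linear_combination -h)

/-- Let `η` be a symmetric edge weighting on the complete graph
`K_m` (`m ≥ 3`) such that in every triangle the minimum weight is attained at least
twice. Then along every cycle (pairwise distinct vertices `v_1, …, v_a`, `a ≥ 3`,
with edges `v_l v_{l+1}` cyclically) the minimum edge weight is attained on at
least two distinct edges. -/
theorem triangle_condition_implies_cycle_condition
    (m : ℕ) (hm : 3 ≤ m) (η : Fin m → Fin m → RInf)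
    (hsym : ∀ i j, η i j = η j i)
    (htri : ∀ i j k : Fin m, i ≠ j → i ≠ k → j ≠ k →
      TwiceMin3 (η i j) (η i k) (η j k))
    (a : ℕ) [NeZero a] (ha : 3 ≤ a)
    (vtx : Fin a → Fin m) (hinj : Function.Injective vtx) :
    ∃ l l' : Fin a, l ≠ l' ∧
      η (vtx l) (vtx (l + 1))
        = Finset.univ.inf (fun t : Fin a => η (vtx t) (vtx (t + 1))) ∧
      η (vtx l') (vtx (l' + 1))
        = Finset.univ.inf (fun t : Fin a => η (vtx t) (vtx (t + 1))) := by
  obtain ⟨l, -, hl⟩ := Finset.exists_mem_eq_inf Finset.univ Finset.univ_nonempty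
    (fun t : Fin a => η (vtx t) (vtx (t + 1)))
  by_contra! hcon
  have hw : ∀ t, t ≠ l → η (vtx l) (vtx (l + 1)) < η (vtx t) (vtx (t + 1)) := fun t ht =>
    lt_of_le_of_ne (hl ▸ Finset.inf_le (Finset.mem_univ t))
      fun h => hcon l t ht.symm hl.symm (h.symm.trans hl.symm)
  have hchord := lt_chord_of_lt_edges htri (by omega) hinj hw (a - 2) (by omega)
  have hlast : l + 1 + Fin.ofNat a (a - 2 + 1) = l := by
    open Fin.CommRing in
    have h : ((a - 2 + 1 + 1 : ℕ) : Fin a) = 0 := by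
      rw [show a - 2 + 1 + 1 = a by omega, Fin.natCast_self]
    have h' : (Fin.ofNat a (a - 2 + 1)) = ((a - 2 + 1 : ℕ) : Fin a) := rfl
    rw [h']
    push_cast at h ⊢
    linear_combination h
  exact hchord.ne ((hsym _ _).trans (congrArg (fun t => η (vtx (l + 1)) (vtx t)) hlast.symm))
end

section
/- Let m, p ≥ 2 and let η : {1,…,m} × {1,…,p} → ℝ∞ (edge weights on the complete bipartite graph K_{m,p}). Suppose that for all 1 ≤ i < l ≤ m and 1 ≤ j < k ≤ p, the minimum of the four values η_{ij}, η_{ik}, η_{lj}, η_{lk} is attained at least twice (i.e., in every 2×2 submatrix of η the minimal entry appears at least twice). Then for every cycle in K_{m,p}, given by pairwise distinct i_1,…,i_a ∈ {1,…,m} and pairwise distinct j_1,…,j_a ∈ {1,…,p} with a ≥ 2, the minimum of the 2a values η_{i_1 j_1}, η_{i_2 j_1}, η_{i_2 j_2}, η_{i_3 j_2}, …, η_{i_a j_a}, η_{i_1 j_a} is attained at least twice: two distinct edges of the cycle have weight equal to this minimum. -/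
open scoped Classical

/-- The minimum of four values in `ℝ∞` is attained at least twice. -/
def TwiceMin4 (x y z u : RInf) : Prop :=
  ∃ p q : Fin 4, p ≠ q ∧
    ![x, y, z, u] p = min (min x y) (min z u) ∧
    ![x, y, z, u] q = min (min x y) (min z u)

theorem TwiceMin4.no_strict_min {x y z u : RInf} (h : TwiceMin4 x y z u) (w : RInf) :
    ¬ (x ≤ w ∧ w < y ∧ w < z ∧ w < u) ∧ ¬ (y ≤ w ∧ w < x ∧ w < z ∧ w < u) ∧
    ¬ (z ≤ w ∧ w < x ∧ w < y ∧ w < u) ∧ ¬ (u ≤ w ∧ w < x ∧ w < y ∧ w < z) := by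
  obtain ⟨p, q, hpq, hp, hq⟩ := h
  fin_cases p <;> fin_cases q <;> simp at hpq hp hq <;> grind

/-- If one entry of a `2×2` submatrix is at most `w` while the opposite entry and one further
entry exceed `w`, then the last entry is at most `w`. -/
theorem le_of_twiceMin4 {m p : ℕ} {η : Fin m → Fin p → RInf}
    (h2x2 : ∀ i l : Fin m, ∀ j k : Fin p, i < l → j < k →
      TwiceMin4 (η i j) (η i k) (η l j) (η l k))
    {w : RInf} {i l : Fin m} {j k : Fin p}
    (hij : η i j ≤ w) (hlj : w < η l j) (hlk : w < η l k) : η i k ≤ w := by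
  by_contra! hik
  rcases lt_trichotomy i l with hil | rfl | hil
  · rcases lt_trichotomy j k with hjk | rfl | hjk
    · have := (h2x2 i l j k hil hjk).no_strict_min w
      tauto
    · exact hik.not_ge hij
    · have := (h2x2 i l k j hil hjk).no_strict_min w
      tauto
  · exact hlj.not_ge hij
  · rcases lt_trichotomy j k with hjk | rfl | hjk
    · have := (h2x2 l i j k hil hjk).no_strict_min w
      tauto
    · exact hik.not_ge hij
    · have := (h2x2 l i k j hil hjk).no_strict_min w
      tauto

/-- Cyclic induction on `Fin a`, starting anywhere. -/
theorem Fin.cyclic_induction {a : ℕ} [NeZero a] {P : Fin a → Prop} {s : Fin a} (hs : P s)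
    (hstep : ∀ t, P t → P (t + 1)) (t : Fin a) : P t := by
  have key : ∀ n : ℕ, P (Fin.ofNat a (s + n)) := by
    intro n
    induction n with
    | zero => simpa using hs
    | succ n ih =>
      convert hstep _ ih using 1
      simp [Fin.ext_iff, Fin.val_add, add_assoc]
  convert key (a - s + t) using 1
  have := s.isLt
  rw [Fin.ext_iff, Fin.val_ofNat, show (s : ℕ) + (a - s + t) = t + a by omega,
    Nat.add_mod_right, Nat.mod_eq_of_lt t.isLt]

/-- Let `η` be an edge weighting on the complete bipartite graph
`K_{m,p}` such that in every `2×2` submatrix the minimal entry appears at least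
twice. Then along every cycle `i_1 - j_1 - i_2 - j_2 - ⋯ - i_a - j_a - i_1`
(pairwise distinct `i`s, pairwise distinct `j`s, `a ≥ 2`), with the `2a` edges
`(i_l, j_l)` and `(i_{l+1}, j_l)` (cyclically), the minimum edge weight is attained
on at least two distinct edges. -/
theorem two_by_two_condition_implies_cycle_condition
    (m p : ℕ) (hm : 2 ≤ m) (hp : 2 ≤ p)
    (η : Fin m → Fin p → RInf)
    (h2x2 : ∀ i l : Fin m, ∀ j k : Fin p, i < l → j < k →
      TwiceMin4 (η i j) (η i k) (η l j) (η l k))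
    (a : ℕ) [NeZero a] (ha : 2 ≤ a)
    (I : Fin a → Fin m) (hI : Function.Injective I)
    (J : Fin a → Fin p) (hJ : Function.Injective J) :
    let c : Fin a × Bool → RInf :=
      fun e => if e.2 then η (I (e.1 + 1)) (J e.1) else η (I e.1) (J e.1)
    ∃ e e' : Fin a × Bool, e ≠ e' ∧
      c e = Finset.univ.inf c ∧ c e' = Finset.univ.inf c := by
  intro c
  have : Nonempty (Fin a × Bool) := ⟨(0, true)⟩
  obtain ⟨e, -, he⟩ := Finset.exists_mem_eq_inf Finset.univ Finset.univ_nonempty c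
  by_contra! hne
  have hlt : ∀ e', e ≠ e' → c e < c e' := fun e' hee' =>
    lt_of_le_of_ne (he ▸ Finset.inf_le (Finset.mem_univ e'))
      (he ▸ (hne e e' hee' he.symm).symm)
  have hfalse : ∀ t, c (t, false) = η (I t) (J t) := fun t => by simp [c]
  have htrue : ∀ t, c (t, true) = η (I (t + 1)) (J t) := fun t => by simp [c]
  obtain ⟨s, b⟩ := e
  cases b with
  | false =>
    have hout : ∀ t, c (s, false) < η (I (t + 1)) (J t) := fun t =>
      htrue t ▸ hlt _ (by simp)
    have hall := Fin.cyclic_induction (P := fun t => η (I s) (J t) ≤ c (s, false))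
      (hfalse s).ge fun t ht => by
        by_cases hts : s = t + 1
        · exact absurd (hts ▸ ht) (hout t).not_ge
        · exact le_of_twiceMin4 h2x2 ht (hout t) (hfalse (t + 1) ▸ hlt _ (by simpa using hts))
    have := hout (s - 1)
    rw [sub_add_cancel] at this
    exact this.not_ge (hall _)
  | true =>
    have hout : ∀ t, c (s, true) < η (I t) (J t) := fun t => hfalse t ▸ hlt _ (by simp)
    have hall := Fin.cyclic_induction (P := fun t => c (s, true) < η (I (s + 1)) (J t))
      (hout (s + 1)) fun t ht => by
        by_contra! hle
        by_cases hts : s = t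
        · exact (hout (t + 1)).not_ge (hts ▸ hle)
        · exact ht.not_ge (le_of_twiceMin4 h2x2 hle (hout (t + 1))
            (htrue t ▸ hlt _ (by simpa using hts)))
    exact (hall s).ne (htrue s)
end
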